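/- Let n = 2m and let f1, f2, f3, f4 be bent functions in n variables such that: (1) there is an m-dimensional subspace U of F_2^n which, for each i = 1,…,4, is the unique m-dimensional M-subspace of f_i; (2) f = f1||f2||f3||f4 is a bent function in n+2 variables. Suppose that for every v ∈ F_2^n and every (m−1)-dimensional subspace V of F_2^n that is an M-subspace of all of f1, f2, f3, f4, there exist u1, u2, u3 ∈ V such that the following three conditions hold simultaneously: (a) the function x ↦ D_{u1}f1(x) + D_{u1}f2(x+v) is not identically zero, or the function x ↦ D_{u1}f3(x) + D_{u1}f4(x+v) is not identically zero; (b) the function x ↦ D_{u2}f1(x) + D_{u2}f3(x+v) is not identically zero, or the function x ↦ D_{u2}f2(x) + D_{u2}f4(x+v) is not identically zero; (c) the function x ↦ D_{u3}f2(x) + D_{u3}f3(x+v) is not identically zero, or the function x ↦ D_{u3}f1(x) + D_{u3}f4(x+v) is not identically zero. Then f has no (m+1)-dimensional M-subspace; i.e., f is outside the completed Maiorana–McFarland class MM^#. -/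

import Mathlib

open scoped BigOperators

/-- The vector space `F_2^n`. -/
abbrev BV (n : ℕ) := Fin n → ZMod 2

/-- Dot product on `F_2^n`. -/
def dotp {n : ℕ} (x y : BV n) : ZMod 2 := ∑ i, x i * y i

/-- `W` is an M-subspace of `f` : all second-order derivatives of `f` in directions
from `W` vanish identically. -/
def IsMSub {M : Type} [AddCommGroup M] [Module (ZMod 2) M] (f : M → ZMod 2)
    (W : Submodule (ZMod 2) M) : Prop :=
  ∀ a ∈ W, ∀ b ∈ W, ∀ x, f x + f (x + a) + f (x + b) + f (x + a + b) = 0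


/-- The bent 4-concatenation `f = f1 || f2 || f3 || f4`:
`f (x, y1, y2) = f1 x + y1 (f1 x + f3 x) + y2 (f1 x + f2 x)
  + y1 y2 (f1 x + f2 x + f3 x + f4 x)`. -/
def concat {X : Type} (f1 f2 f3 f4 : X → ZMod 2) :
    X × (ZMod 2 × ZMod 2) → ZMod 2 :=
  fun p =>
    f1 p.1 + p.2.1 * (f1 p.1 + f3 p.1) + p.2.2 * (f1 p.1 + f2 p.1)
      + p.2.1 * p.2.2 * (f1 p.1 + f2 p.1 + f3 p.1 + f4 p.1)

/-- Walsh–Hadamard transform of `f : F_2^n → F_2` at `a`. -/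
def walsh {n : ℕ} (f : BV n → ZMod 2) (a : BV n) : ℤ :=
  ∑ x : BV n, (-1 : ℤ) ^ (f x + dotp a x).val

/-- Walsh–Hadamard transform of a function on `F_2^n × F_2 × F_2` at `a`. -/
def walshC {n : ℕ} (f : BV n × (ZMod 2 × ZMod 2) → ZMod 2)
    (a : BV n × (ZMod 2 × ZMod 2)) : ℤ :=
  ∑ p : BV n × (ZMod 2 × ZMod 2),
    (-1 : ℤ) ^ (f p + dotp a.1 p.1 + a.2.1 * p.2.1 + a.2.2 * p.2.2).val

theorem Submodule.exists_finrank_eq_of_le_of_le {K V : Type*} [Field K] [AddCommGroup V]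
    [Module K V] [FiniteDimensional K V] {A B : Submodule K V} (hAB : A ≤ B) {k : ℕ}
    (hA : Module.finrank K A ≤ k) (hB : k ≤ Module.finrank K B) :
    ∃ C : Submodule K V, A ≤ C ∧ C ≤ B ∧ Module.finrank K C = k := by
  induction k, hA using Nat.le_induction with
  | base => exact ⟨A, le_rfl, hAB, rfl⟩
  | succ k _ ih =>
    obtain ⟨C, hAC, hCB, hC⟩ := ih (by omega)
    have hnot : ¬ B ≤ C := fun h => by
      have := Submodule.finrank_mono h
      omega
    obtain ⟨w, hwB, hwC⟩ := SetLike.not_le_iff_exists.1 hnot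
    have hw : w ≠ 0 := by
      rintro rfl
      exact hwC C.zero_mem
    refine ⟨C ⊔ K ∙ w, hAC.trans le_sup_left,
      sup_le hCB ((Submodule.span_singleton_le_iff_mem _ _).2 hwB), ?_⟩
    have hdim := Submodule.finrank_sup_add_finrank_inf_eq C (K ∙ w)
    have hdisj : C ⊓ K ∙ w = ⊥ := ((Submodule.disjoint_span_singleton' hw).2 hwC).eq_bot
    rw [hdisj, finrank_bot, finrank_span_singleton hw, hC] at hdim
    exact hdim

theorem IsMSub.mono {M : Type} [AddCommGroup M] [Module (ZMod 2) M] {f : M → ZMod 2}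
    {V W : Submodule (ZMod 2) M} (hW : IsMSub f W) (hVW : V ≤ W) : IsMSub f V :=
  fun a ha b hb => hW a (hVW ha) b (hVW hb)

theorem IsMSub.finrank_le_of_unique {n m : ℕ} (hnm : n = 2 * m) {f : BV n → ZMod 2}
    {U : Submodule (ZMod 2) (BV n)} (hUdim : Module.finrank (ZMod 2) U = m)
    (hU : ∀ W : Submodule (ZMod 2) (BV n), Module.finrank (ZMod 2) W = m → IsMSub f W → W = U)
    {W : Submodule (ZMod 2) (BV n)} (hW : IsMSub f W) : Module.finrank (ZMod 2) W ≤ m := by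
  rcases Nat.eq_zero_or_pos m with rfl | hm
  · have := Submodule.finrank_le W
    rw [Module.finrank_fin_fun] at this
    omega
  · by_contra! hlt
    have hle : W ≤ U := fun w hw => by
      obtain ⟨C, hwC, hCW, hC⟩ := Submodule.exists_finrank_eq_of_le_of_le
        ((Submodule.span_singleton_le_iff_mem w W).2 hw)
        ((finrank_span_le_card {w}).trans (by simpa using Nat.succ_le_of_lt hm)) hlt.le
      rw [← hU C hC (hW.mono hCW)]
      exact hwC (Submodule.mem_span_singleton_self w)
    have := Submodule.finrank_mono hle
    omega

theorem IsMSub.comap_inl {X Y : Type} [AddCommGroup X] [Module (ZMod 2) X] [AddCommGroup Y]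
    [Module (ZMod 2) Y] {f : X × Y → ZMod 2} {W : Submodule (ZMod 2) (X × Y)} (hW : IsMSub f W)
    (y : Y) : IsMSub (fun x => f (x, y)) (W.comap (LinearMap.inl (ZMod 2) X Y)) :=
  fun a ha b hb x => by simpa using hW (a, 0) ha (b, 0) hb (x, y)

theorem IsMSub.translate {X Y : Type} [AddCommGroup X] [Module (ZMod 2) X] [AddCommGroup Y]
    [Module (ZMod 2) Y] {f : X × Y → ZMod 2} {W : Submodule (ZMod 2) (X × Y)} (hW : IsMSub f W)
    {u v : X} {c : Y} (hu : u ∈ W.comap (LinearMap.inl (ZMod 2) X Y)) (hv : (v, c) ∈ W)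
    (x : X) (y : Y) :
    (f (x + u, y) + f (x, y)) + (f (x + v + u, y + c) + f (x + v, y + c)) = 0 := by
  have h := hW (v, c) hv (u, 0) hu (x, y)
  simp only [Prod.mk_add_mk, add_zero] at h
  linear_combination h

theorem Submodule.finrank_le_finrank_comap_inl_add {K X Y : Type*} [Field K] [AddCommGroup X]
    [Module K X] [FiniteDimensional K X] [AddCommGroup Y] [Module K Y] [FiniteDimensional K Y]
    (W : Submodule K (X × Y)) :
    Module.finrank K W ≤ Module.finrank K (W.comap (LinearMap.inl K X Y)) + Module.finrank K Y := by
  have hdim := Submodule.finrank_sup_add_finrank_inf_eq (LinearMap.range (LinearMap.inl K X Y)) W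
  have hsup := Submodule.finrank_le (LinearMap.range (LinearMap.inl K X Y) ⊔ W)
  rw [← Submodule.map_comap_eq, (Submodule.equivMapOfInjective _ LinearMap.inl_injective
    _).symm.finrank_eq, LinearMap.finrank_range_of_inj LinearMap.inl_injective] at hdim
  rw [Module.finrank_prod] at hsup
  omega

theorem Submodule.finrank_le_finrank_comap_inl {K X Y : Type*} [Field K] [AddCommGroup X]
    [Module K X] [FiniteDimensional K X] [AddCommGroup Y] [Module K Y] {W : Submodule K (X × Y)}
    (hW : ∀ p ∈ W, p.2 = 0) :
    Module.finrank K W ≤ Module.finrank K (W.comap (LinearMap.inl K X Y)) := by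
  have hle : W ≤ (W.comap (LinearMap.inl K X Y)).map (LinearMap.inl K X Y) := by
    rintro ⟨x, y⟩ hp
    obtain rfl : y = 0 := hW _ hp
    exact ⟨x, hp, rfl⟩
  exact (Submodule.finrank_mono hle).trans (Submodule.finrank_map_le _ _)

section Concat

variable {X : Type} (f1 f2 f3 f4 : X → ZMod 2) (x : X)

theorem concat_zero_zero : concat f1 f2 f3 f4 (x, (0, 0)) = f1 x := by simp [concat]

theorem concat_zero_one : concat f1 f2 f3 f4 (x, (0, 1)) = f2 x := by
  simp [concat, ← add_assoc, CharTwo.add_self_eq_zero]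

theorem concat_one_zero : concat f1 f2 f3 f4 (x, (1, 0)) = f3 x := by
  simp [concat, ← add_assoc, CharTwo.add_self_eq_zero]

theorem concat_one_one : concat f1 f2 f3 f4 (x, (1, 1)) = f4 x := by
  simp only [concat, one_mul]
  linear_combination (f1 x * 2 + f2 x + f3 x) * CharTwo.two_eq_zero (R := ZMod 2)

end Concat

theorem stmt16 {n m : ℕ} (hnm : n = 2 * m)
    (f1 f2 f3 f4 : BV n → ZMod 2)
    (hb1 : ∀ a, walsh f1 a = 2 ^ m ∨ walsh f1 a = -(2 ^ m))
    (hb2 : ∀ a, walsh f2 a = 2 ^ m ∨ walsh f2 a = -(2 ^ m))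
    (hb3 : ∀ a, walsh f3 a = 2 ^ m ∨ walsh f3 a = -(2 ^ m))
    (hb4 : ∀ a, walsh f4 a = 2 ^ m ∨ walsh f4 a = -(2 ^ m))
    (U : Submodule (ZMod 2) (BV n)) (hUdim : Module.finrank (ZMod 2) ↥U = m)
    (hU1 : IsMSub f1 U ∧ ∀ W : Submodule (ZMod 2) (BV n),
      Module.finrank (ZMod 2) ↥W = m → IsMSub f1 W → W = U)
    (hU2 : IsMSub f2 U ∧ ∀ W : Submodule (ZMod 2) (BV n),
      Module.finrank (ZMod 2) ↥W = m → IsMSub f2 W → W = U)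
    (hU3 : IsMSub f3 U ∧ ∀ W : Submodule (ZMod 2) (BV n),
      Module.finrank (ZMod 2) ↥W = m → IsMSub f3 W → W = U)
    (hU4 : IsMSub f4 U ∧ ∀ W : Submodule (ZMod 2) (BV n),
      Module.finrank (ZMod 2) ↥W = m → IsMSub f4 W → W = U)
    (hbent : ∀ a, walshC (concat f1 f2 f3 f4) a = 2 ^ (m + 1) ∨
      walshC (concat f1 f2 f3 f4) a = -(2 ^ (m + 1)))
    (hcond : ∀ v : BV n, ∀ V : Submodule (ZMod 2) (BV n),
      Module.finrank (ZMod 2) ↥V = m - 1 →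
      IsMSub f1 V → IsMSub f2 V → IsMSub f3 V → IsMSub f4 V →
      ∃ u1 ∈ V, ∃ u2 ∈ V, ∃ u3 ∈ V,
        ((¬ ∀ x, (f1 (x + u1) + f1 x) + (f2 (x + v + u1) + f2 (x + v)) = 0) ∨
         (¬ ∀ x, (f3 (x + u1) + f3 x) + (f4 (x + v + u1) + f4 (x + v)) = 0)) ∧
        ((¬ ∀ x, (f1 (x + u2) + f1 x) + (f3 (x + v + u2) + f3 (x + v)) = 0) ∨
         (¬ ∀ x, (f2 (x + u2) + f2 x) + (f4 (x + v + u2) + f4 (x + v)) = 0)) ∧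
        ((¬ ∀ x, (f2 (x + u3) + f2 x) + (f3 (x + v + u3) + f3 (x + v)) = 0) ∨
         (¬ ∀ x, (f1 (x + u3) + f1 x) + (f4 (x + v + u3) + f4 (x + v)) = 0))) :
    ¬ ∃ W : Submodule (ZMod 2) (BV n × (ZMod 2 × ZMod 2)),
      Module.finrank (ZMod 2) ↥W = m + 1 ∧ IsMSub (concat f1 f2 f3 f4) W := by
  rintro ⟨W, hWdim, hW⟩
  set W₀ := W.comap (LinearMap.inl (ZMod 2) (BV n) (ZMod 2 × ZMod 2))
  have h00 (x : BV n) := concat_zero_zero f1 f2 f3 f4 x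
  have h01 (x : BV n) := concat_zero_one f1 f2 f3 f4 x
  have h10 (x : BV n) := concat_one_zero f1 f2 f3 f4 x
  have h11 (x : BV n) := concat_one_one f1 f2 f3 f4 x
  have hM1 : IsMSub f1 W₀ := by simpa only [h00] using hW.comap_inl (0, 0)
  have hM2 : IsMSub f2 W₀ := by simpa only [h01] using hW.comap_inl (0, 1)
  have hM3 : IsMSub f3 W₀ := by simpa only [h10] using hW.comap_inl (1, 0)
  have hM4 : IsMSub f4 W₀ := by simpa only [h11] using hW.comap_inl (1, 1)
  have hW₀le := hM1.finrank_le_of_unique hnm hUdim hU1.2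
  obtain ⟨⟨v, c⟩, hvW, hc⟩ : ∃ p ∈ W, p.2 ≠ 0 := by
    by_contra! hzero
    have : Module.finrank (ZMod 2) W ≤ Module.finrank (ZMod 2) W₀ :=
      Submodule.finrank_le_finrank_comap_inl hzero
    omega
  have hW₀ge : m - 1 ≤ Module.finrank (ZMod 2) W₀ := by
    have : _ ≤ Module.finrank (ZMod 2) W₀ + _ := W.finrank_le_finrank_comap_inl_add
    rw [Module.finrank_prod, Module.finrank_self] at this
    omega
  obtain ⟨V, -, hVW, hV⟩ := Submodule.exists_finrank_eq_of_le_of_le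
    (bot_le : ⊥ ≤ W₀) (by simp) hW₀ge
  obtain ⟨u1, hu1, u2, hu2, u3, hu3, ha, hb, hc'⟩ := hcond v V hV (hM1.mono hVW) (hM2.mono hVW)
    (hM3.mono hVW) (hM4.mono hVW)
  have key {u : BV n} (hu : u ∈ V) := hW.translate (hVW hu) hvW
  have hone : (1 : ZMod 2) + 1 = 0 := rfl
  obtain ⟨c1, c2⟩ := c
  have hcases : ∀ c : ZMod 2, c = 0 ∨ c = 1 := by decide
  rcases hcases c1 with rfl | rfl <;> rcases hcases c2 with rfl | rfl
  · exact hc rfl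
  · refine ha.elim (· fun x => ?_) (· fun x => ?_)
    · simpa [h00, h01] using key hu1 x (0, 0)
    · simpa [h10, h11] using key hu1 x (1, 0)
  · refine hb.elim (· fun x => ?_) (· fun x => ?_)
    · simpa [h00, h10] using key hu2 x (0, 0)
    · simpa [h01, h11] using key hu2 x (0, 1)
  · refine hc'.elim (· fun x => ?_) (· fun x => ?_)
    · simpa [h01, h10, hone] using key hu3 x (0, 1)
    · simpa [h00, h11] using key hu3 x (0, 0)
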